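/- Let τ be an integer with τ ≥ 2, ρ an integer relatively prime to 2τ, θ = ρπ/τ, and ω = e^{iθ}. Let F be a finite field with q = |F| elements, E a finite set, and G a matrix over F with columns indexed by E, of rank r. For k = 0, 1, …, 2τ−1, let ℳ_{1,τ−1}(k, 2τ) be the set of pairs (f, g) of functions f, g : E → F such that f − g is a flow of G and |supp(f)| + (τ−1)|supp(g)| ≡ k mod 2τ. Then Σ_{k=0}^{2τ−1} ω^k |ℳ_{1,τ−1}(k, 2τ)| = (−2i sin θ)^r (2i sin θ + 2 − q)^{|E|−r} R(M(G); −q(2i sin θ + 2 − q)/(2i sin θ), −2i sin θ/(2i sin θ + 2 − q)). -/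

import Mathlib

open Finset

lemma sum_twoValued_mul {F : Type*} [Field F] [Fintype F] [DecidableEq F] (α β : ℂ) (x : F) :
    ∑ y : F, (if x + y ≠ 0 then α else 1) * (if y ≠ 0 then β else 1)
      = (if x = 0 then (1 - α) * (1 - β) else 0)
        + (Fintype.card F * (α * β) + (1 - β) * α + (1 - α) * β) := by
  have h : ∀ y : F, (if x + y ≠ 0 then α else 1) * (if y ≠ 0 then β else 1)
      = α * β + (if y = 0 then (1 - β) * α else 0) + (if y = -x then (1 - α) * β else 0)
        + (if y = 0 then (if x = 0 then (1 - α) * (1 - β) else 0) else 0) := by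
    intro y
    have hxy : x + y = 0 ↔ y = -x := by rw [add_comm, eq_neg_iff_add_eq_zero]
    by_cases hy : y = 0
    · subst hy
      by_cases hx : x = 0
      · simp [hx]; ring
      · simp [hx]; ring
    · by_cases hx : y = -x
      · have hx0 : x ≠ 0 := by rintro rfl; simp at hx; exact hy hx
        simp [hx, hx0]; ring
      · simp [hxy, hx, hy]
  simp only [h, sum_add_distrib, sum_ite_eq', mem_univ, if_true, sum_const, card_univ,
    nsmul_eq_mul]
  ring

lemma pow_card_filter {ι : Type*} [Fintype ι] (p : ι → Prop) [DecidablePred p] (z : ℂ) :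
    z ^ (univ.filter p).card = ∏ e, if p e then z else 1 := by
  rw [prod_ite]; simp

/-- Row rank equals column rank for the columns indexed by `B`. -/
lemma finrank_span_columns {F ι : Type*} [Field F] [Finite ι] {n : ℕ}
    (G : Fin n → ι → F) (B : Finset ι) :
    Module.finrank F (Submodule.span F ((fun e => fun i => G i e) '' (B : Set ι)))
      = Module.finrank F ((Submodule.span F (Set.range G)).map
          (LinearMap.funLeft F F (fun e : B => (e : ι)))) := by
  let A : Matrix (Fin n) B F := fun i e => G i e
  have h1 : ((fun e => fun i => G i e) '' (B : Set ι)) = Set.range A.col := by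
    ext v
    simp only [Set.mem_image, Set.mem_range, Matrix.col_def]
    constructor
    · rintro ⟨e, he, rfl⟩
      exact ⟨⟨e, he⟩, rfl⟩
    · rintro ⟨⟨e, he⟩, rfl⟩
      exact ⟨e, he, rfl⟩
  have h2 : (LinearMap.funLeft F F (fun e : B => (e : ι))) '' (Set.range G)
      = Set.range A.row := by
    rw [← Set.range_comp]; rfl
  rw [Submodule.map_span, h1, h2, ← Matrix.rank_eq_finrank_span_cols,
    ← Matrix.rank_eq_finrank_span_row]

/-- The row-space vectors vanishing on `B` are counted by the corank of `B`. -/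
lemma card_rowSpace_vanishing {F : Type*} [Field F] [Fintype F] [DecidableEq F]
    {ι : Type*} [Fintype ι] [DecidableEq ι] {n : ℕ} (G : Fin n → ι → F)
    (rk : Finset ι → ℕ)
    (hrk : ∀ B : Finset ι,
      rk B = Module.finrank F (Submodule.span F ((fun e => fun i => G i e) '' (B : Set ι))))
    (Flow : (ι → F) → Prop) [DecidablePred Flow]
    (hFlow : ∀ h : ι → F, Flow h ↔ h ∈ Submodule.span F (Set.range G))
    (B : Finset ι) :
    (univ.filter (fun h : ι → F => Flow h ∧ ∀ e ∈ B, h e = 0)).card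
      = Fintype.card F ^ (rk univ - rk B) := by
  set W := Submodule.span F (Set.range G)
  let φ := (LinearMap.funLeft F F (fun e : B => (e : ι))).domRestrict W
  have hrkB (C : Finset ι) : rk C = Module.finrank F
      (W.map (LinearMap.funLeft F F (fun e : C => (e : ι)))) := by
    rw [hrk, finrank_span_columns]
  have huniv : rk univ = Module.finrank F W := by
    rw [hrkB]
    refine (Submodule.equivMapOfInjective _ ?_ W).finrank_eq.symm
    exact LinearMap.funLeft_injective_of_surjective _ _ _ fun e => ⟨⟨e, mem_univ e⟩, rfl⟩
  have hrange : LinearMap.range φ = W.map (LinearMap.funLeft F F (fun e : B => (e : ι))) :=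
    LinearMap.range_domRestrict _ _
  have hker : Module.finrank F (LinearMap.ker φ) = rk univ - rk B := by
    have := φ.finrank_range_add_finrank_ker
    rw [hrange, ← hrkB, ← huniv] at this
    omega
  rw [← hker, ← Nat.card_eq_fintype_card, ← Module.natCard_eq_pow_finrank (K := F) (V := LinearMap.ker φ),
    ← Fintype.card_subtype, ← Nat.card_eq_fintype_card]
  refine Nat.card_congr
    { toFun := fun h => ⟨⟨h.1, (hFlow _).1 h.2.1⟩, ?_⟩
      invFun := fun h => ⟨h.1.1, (hFlow _).2 h.1.2, ?_⟩
      left_inv := fun _ => rfl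
      right_inv := fun _ => rfl }
  · rw [LinearMap.mem_ker]
    ext e
    exact h.2.2 e e.2
  · intro e he
    exact congrFun (LinearMap.mem_ker.1 h.2) ⟨e, he⟩

lemma sum_range_pow_mul_card_filter {α : Type*} [Fintype α] (P : α → Prop) [DecidablePred P]
    (w : α → ℕ) {N : ℕ} (hN : 0 < N) {ω : ℂ} (hω : ω ^ N = 1) :
    ∑ k ∈ range N, ω ^ k * ((univ.filter (fun p => P p ∧ w p % N = k)).card : ℂ)
      = ∑ p ∈ univ.filter P, ω ^ w p := by
  have h (k : ℕ) : ω ^ k * ((univ.filter (fun p => P p ∧ w p % N = k)).card : ℂ)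
      = ∑ p ∈ univ.filter P, if w p % N = k then ω ^ k else 0 := by
    rw [← filter_filter, ← sum_filter, sum_const, nsmul_eq_mul, mul_comm]
  simp only [h]
  rw [sum_comm]
  refine sum_congr rfl fun p _ => ?_
  rw [sum_ite_eq, if_pos (mem_range.2 (Nat.mod_lt _ hN)), ← pow_eq_pow_mod _ hω]

lemma sum_pairs_eq_sum_flow {F : Type*} [Field F] [Fintype F] [DecidableEq F]
    {ι : Type*} [Fintype ι] [DecidableEq ι] (Flow : (ι → F) → Prop) [DecidablePred Flow]
    (α β : ℂ) :
    ∑ p ∈ univ.filter (fun p : (ι → F) × (ι → F) => Flow (p.1 - p.2)),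
        α ^ (univ.filter (fun e => p.1 e ≠ 0)).card * β ^ (univ.filter (fun e => p.2 e ≠ 0)).card
      = ∑ h ∈ univ.filter Flow, ∏ e,
          ∑ y : F, (if h e + y ≠ 0 then α else 1) * (if y ≠ 0 then β else 1) := by
  have hprod (h : ι → F) :
      ∏ e, ∑ y : F, (if h e + y ≠ 0 then α else 1) * (if y ≠ 0 then β else 1)
        = ∑ g : ι → F, α ^ (univ.filter (fun e => h e + g e ≠ 0)).card
            * β ^ (univ.filter (fun e => g e ≠ 0)).card := by
    rw [prod_univ_sum, Fintype.piFinset_univ]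
    simp only [pow_card_filter, prod_mul_distrib]
  simp only [hprod]
  rw [← sum_product']
  refine sum_nbij' (fun p => (p.1 - p.2, p.2)) (fun p => (p.1 + p.2, p.2)) ?_ ?_ ?_ ?_ ?_
  all_goals simp

lemma sum_flow_eq_sum_subsets {F : Type*} [Field F] [Fintype F] [DecidableEq F]
    {ι : Type*} [Fintype ι] [DecidableEq ι] (Flow : (ι → F) → Prop) [DecidablePred Flow]
    (u t : ℂ) :
    ∑ h ∈ univ.filter Flow, ∏ e, ((if h e = 0 then u else 0) + t)
      = ∑ B : Finset ι, u ^ B.card * t ^ (Fintype.card ι - B.card)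
          * ((univ.filter (fun h : ι → F => Flow h ∧ ∀ e ∈ B, h e = 0)).card : ℂ) := by
  simp only [prod_add, powerset_univ]
  rw [sum_comm]
  refine sum_congr rfl fun B _ => ?_
  rw [← filter_filter, mul_comm, ← nsmul_eq_mul, ← sum_const, sum_filter (p := fun h => ∀ e ∈ B, _)]
  refine sum_congr rfl fun h _ => ?_
  rw [prod_const, card_sdiff_of_subset (subset_univ B), card_univ]
  split_ifs with hB
  · rw [prod_congr rfl (fun e he => if_pos (hB e he)), prod_const]
  · push Not at hB
    obtain ⟨e, he, hne⟩ := hB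
    rw [prod_eq_zero he (if_neg hne), zero_mul]

lemma rankTerm_eq {s t q : ℂ} (hs : s ≠ 0) (ht : t ≠ 0) {r m k b : ℕ}
    (hkr : k ≤ r) (hkb : k ≤ b) (hbm : b ≤ m) (hrm : r ≤ m) :
    (-s) ^ r * t ^ (m - r) * ((-q * t / s) ^ (r - k) * (-s / t) ^ (b - k))
      = (-s) ^ b * t ^ (m - b) * q ^ (r - k) := by
  obtain ⟨c, rfl⟩ := Nat.exists_eq_add_of_le hkr
  obtain ⟨d, rfl⟩ := Nat.exists_eq_add_of_le hkb
  have h1 : -q * t / s = q * t / (-s) := by field_simp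
  have hs' : -s ≠ 0 := neg_ne_zero.2 hs
  rw [h1]
  generalize -s = v at hs'
  simp only [Nat.add_sub_cancel_left, div_pow, mul_pow]
  have h2 : t ^ (m - (k + c)) * t ^ c = t ^ (m - (k + d)) * t ^ d := by
    rw [← pow_add, ← pow_add]; congr 1; omega
  rw [pow_add, pow_add]
  field_simp
  linear_combination q ^ c * h2

lemma sin_mul_pi_div_ne_zero {τ : ℕ} (hτ : 2 ≤ τ) {ρ : ℤ}
    (hρ : Int.gcd ρ ((2 * τ : ℕ) : ℤ) = 1) : Real.sin ((ρ : ℝ) * Real.pi / τ) ≠ 0 := by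
  rw [Ne, Real.sin_eq_zero_iff]
  rintro ⟨n, hn⟩
  have hτ0 : (τ : ℝ) ≠ 0 := by positivity
  have h : (n : ℝ) * τ = ρ := by
    rw [eq_div_iff hτ0] at hn
    refine mul_right_cancel₀ Real.pi_ne_zero ?_
    linarith
  have hdvd : (τ : ℤ) ∣ ρ := ⟨n, by rw [mul_comm]; exact_mod_cast h.symm⟩
  have : (τ : ℤ) ∣ Int.gcd ρ ((2 * τ : ℕ) : ℤ) := Int.dvd_coe_gcd hdvd (by simp)
  rw [hρ] at this
  have := Int.le_of_dvd (by norm_num) this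
  omega

lemma exp_pow_eq_neg_one {τ : ℕ} (hτ : 2 ≤ τ) {ρ : ℤ}
    (hρ : Int.gcd ρ ((2 * τ : ℕ) : ℤ) = 1) :
    Complex.exp (((ρ : ℝ) * Real.pi / τ : ℝ) * Complex.I) ^ τ = -1 := by
  have hodd : Odd ρ := by
    rw [← Int.not_even_iff_odd]
    intro he
    have : (2 : ℤ) ∣ Int.gcd ρ ((2 * τ : ℕ) : ℤ) := Int.dvd_coe_gcd he.two_dvd (by simp)
    rw [hρ] at this
    norm_num at this
  have hτ0 : (τ : ℂ) ≠ 0 := by norm_cast; omega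
  rw [← Complex.exp_nat_mul]
  have : (τ : ℂ) * (((ρ : ℝ) * Real.pi / τ : ℝ) * Complex.I) = ρ * (Real.pi * Complex.I) := by
    push_cast; field_simp
  rw [this, Complex.exp_int_mul, Complex.exp_pi_mul_I, hodd.neg_one_zpow]

/-- **Theorem 4.13.** Parcels defined by `|supp(f)| + (τ−1)|supp(g)| ≡ k mod 2τ`. -/
theorem stmt_10
    {F : Type*} [Field F] [Fintype F] [DecidableEq F]
    {ι : Type*} [Fintype ι] [DecidableEq ι]
    {n : ℕ} (G : Fin n → ι → F)
    (q : ℕ) (hq : q = Fintype.card F)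
    (rk : Finset ι → ℕ)
    (hrk : ∀ B : Finset ι,
      rk B = Module.finrank F (Submodule.span F ((fun e => fun i => G i e) '' (B : Set ι))))
    (r : ℕ) (hr : r = rk Finset.univ)
    (Flow : (ι → F) → Prop) [DecidablePred Flow]
    (hFlow : ∀ h : ι → F, Flow h ↔ h ∈ Submodule.span F (Set.range G))
    (τ : ℕ) (hτ : 2 ≤ τ)
    (ρ : ℤ) (hρ : Int.gcd ρ ((2 * τ : ℕ) : ℤ) = 1)
    (θ : ℝ) (hθ : θ = (ρ : ℝ) * Real.pi / (τ : ℝ))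
    (ω : ℂ) (hω : ω = Complex.exp (θ * Complex.I)) :
    ∑ k ∈ Finset.range (2 * τ), ω ^ k *
        ((Finset.univ.filter (fun p : (ι → F) × (ι → F) =>
          Flow (p.1 - p.2) ∧
            ((Finset.univ.filter (fun e => p.1 e ≠ 0)).card
              + (τ - 1) * (Finset.univ.filter (fun e => p.2 e ≠ 0)).card) % (2 * τ)
              = k)).card : ℂ)
      = (-2 * Complex.I * (Real.sin θ : ℂ)) ^ r
          * (2 * Complex.I * (Real.sin θ : ℂ) + 2 - (q : ℂ)) ^ (Fintype.card ι - r) *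
          ∑ B : Finset ι,
            (-(q : ℂ) * (2 * Complex.I * (Real.sin θ : ℂ) + 2 - (q : ℂ))
                / (2 * Complex.I * (Real.sin θ : ℂ))) ^ (r - rk B) *
              (-2 * Complex.I * (Real.sin θ : ℂ)
                / (2 * Complex.I * (Real.sin θ : ℂ) + 2 - (q : ℂ))) ^ (B.card - rk B) := by
  have hsin : Real.sin θ ≠ 0 := hθ ▸ sin_mul_pi_div_ne_zero hτ hρ
  have hωτ : ω ^ τ = -1 := by rw [hω, hθ]; exact exp_pow_eq_neg_one hτ hρ
  have hω1 : ω ^ (2 * τ) = 1 := by rw [mul_comm, pow_mul, hωτ]; norm_num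
  have hωβ : ω * ω ^ (τ - 1) = -1 := by rw [← pow_succ', Nat.sub_add_cancel (by omega), hωτ]
  have hωs : ω + ω ^ (τ - 1) = 2 * Complex.I * (Real.sin θ : ℂ) := by
    have hω0 : ω ≠ 0 := by rw [hω]; exact Complex.exp_ne_zero _
    have hinv : ω ^ (τ - 1) = -Complex.exp (-(θ * Complex.I)) := by
      refine mul_left_cancel₀ hω0 ?_
      rw [hωβ, hω, mul_neg, ← Complex.exp_add, add_neg_cancel, Complex.exp_zero]
    rw [hinv, hω, ← neg_mul, Complex.exp_mul_I, Complex.exp_mul_I, Complex.cos_neg,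
      Complex.sin_neg, Complex.ofReal_sin]
    ring
  rw [sum_range_pow_mul_card_filter (fun p : (ι → F) × (ι → F) => Flow (p.1 - p.2)) _
    (by omega) hω1]
  simp only [pow_add, pow_mul]
  rw [sum_pairs_eq_sum_flow]
  simp only [sum_twoValued_mul, ← hq]
  generalize hβ : ω ^ (τ - 1) = β at *
  rw [show -2 * Complex.I * (Real.sin θ : ℂ) = -(2 * Complex.I * (Real.sin θ : ℂ)) by ring]
  have hs : 2 * Complex.I * (Real.sin θ : ℂ) ≠ 0 := by
    simpa [-Complex.ofReal_sin] using hsin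
  have ht : 2 * Complex.I * (Real.sin θ : ℂ) + 2 - (q : ℂ) ≠ 0 := by
    intro h
    have := congrArg Complex.im h
    simp [-Complex.ofReal_sin] at this
    exact hsin this
  generalize 2 * Complex.I * (Real.sin θ : ℂ) = s at *
  rw [show (1 - ω) * (1 - β) = -s by linear_combination hωβ - hωs,
    show (q : ℂ) * (ω * β) + (1 - β) * ω + (1 - ω) * β = s + 2 - q by
      linear_combination (q - 2 : ℂ) * hωβ + hωs,
    sum_flow_eq_sum_subsets, mul_sum]
  refine sum_congr rfl fun B _ => ?_
  have hle (C : Finset ι) : rk C ≤ C.card := by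
    rw [hrk, ← coe_image]
    exact (finrank_span_finset_le_card _).trans card_image_le
  have hmono : rk B ≤ r := by
    rw [hr, hrk, hrk]
    exact Submodule.finrank_mono (Submodule.span_mono (Set.image_mono (by simp)))
  rw [rankTerm_eq hs ht hmono (hle B) (card_le_univ B) (hr ▸ hle univ),
    card_rowSpace_vanishing G rk hrk Flow hFlow, ← hq, ← hr, Nat.cast_pow]
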